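/- arXiv:2510.09514 — 4 statements merged into one kernel-verified Lean document; each statement's English description precedes it below -/
import Mathlib

section
/- Suppose u, u̇ ∈ V, F : V → ℝ is a continuous linear functional, and ε ≥ 0 satisfy: (i) |F(w)| ≤ ε‖w‖ for all w ∈ W (modeling the higher-order bound |⟨f,w⟩_{L²}| ≲ H^{p+2}‖f‖_{H^k}‖∇w‖ for w in the kernel of Π_H); (ii) a(u, w) = F(w) − b(u̇, w) for all w ∈ W (the weak parabolic equation tested with kernel functions); and (iii) ũ ∈ V satisfies u − ũ ∈ W and a(ũ, w) = 0 for all w ∈ W (ũ is the a-orthogonal multiscale projection of u). Then ‖u − (ũ + D u̇)‖ ≤ ε/α. (Abstract form of Lemma 'Error of the ideal enriched correction': the multiscale projection plus one enriched correction of the time derivative approximates u to higher order.) -/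
/-- abstract form of the error estimate for the ideal enriched
correction: if `a u w = F w - b u̇ w` on `W`, `|F w| ≤ ε ‖w‖` on `W`, and `ũ`
is the a-orthogonal multiscale projection of `u`, then
`‖u - (ũ + D u̇)‖ ≤ ε / α`. -/
theorem ideal_enriched_correction_error
    {V : Type*} [NormedAddCommGroup V] [InnerProductSpace ℝ V] [CompleteSpace V]
    (W : Submodule ℝ V) (hWclosed : IsClosed (W : Set V))
    (a : V → V → ℝ)
    (ha_add : ∀ u v w : V, a (u + v) w = a u w + a v w)
    (ha_smul : ∀ (c : ℝ) (u w : V), a (c • u) w = c * a u w)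
    (ha_symm : ∀ u v : V, a u v = a v u)
    (α β : ℝ) (hα : 0 < α) (hαβ : α ≤ β)
    (ha_coercive : ∀ v : V, α * ‖v‖ ^ 2 ≤ a v v)
    (ha_bound : ∀ v w : V, |a v w| ≤ β * ‖v‖ * ‖w‖)
    (b : V → V → ℝ)
    (hb_add_left : ∀ u v w : V, b (u + v) w = b u w + b v w)
    (hb_smul_left : ∀ (c : ℝ) (u w : V), b (c • u) w = c * b u w)
    (hb_add_right : ∀ u v w : V, b u (v + w) = b u v + b u w)
    (hb_smul_right : ∀ (c : ℝ) (u w : V), b u (c • w) = c * b u w)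
    (γ : ℝ) (hγ : 0 < γ)
    (hb_bound : ∀ v : V, ∀ w ∈ W, |b v w| ≤ γ * ‖v‖ * ‖w‖)
    -- the enriched correction operator D
    (D : V → V) (hD_mem : ∀ v : V, D v ∈ W)
    (hD_eq : ∀ v : V, ∀ w ∈ W, a (D v) w = - b v w)
    -- data of the statement
    (u udot : V) (F : V →L[ℝ] ℝ) (ε : ℝ) (hε : 0 ≤ ε)
    (hF : ∀ w ∈ W, |F w| ≤ ε * ‖w‖)
    (heq : ∀ w ∈ W, a u w = F w - b udot w)
    (utilde : V) (hutilde_mem : u - utilde ∈ W)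
    (hutilde_orth : ∀ w ∈ W, a utilde w = 0) :
    ‖u - (utilde + D udot)‖ ≤ ε / α := by
  set e := u - (utilde + D udot) with he
  have heW : e ∈ W := by
    rw [he, ← sub_sub]
    exact W.sub_mem hutilde_mem (hD_mem udot)
  have hu : u = e + (utilde + D udot) := (sub_add_cancel _ _).symm
  have haee : a e e = F e := by
    have h := heq e heW
    have hsplit : a u e = a e e + (a utilde e + a (D udot) e) := by
      rw [← ha_add, ← ha_add, ← hu]
    linarith [hutilde_orth e heW, hD_eq udot e heW]
  have hsq : α * ‖e‖ ^ 2 ≤ ε * ‖e‖ :=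
    (ha_coercive e).trans (haee.trans_le ((le_abs_self _).trans (hF e heW)))
  rw [le_div_iff₀ hα]
  rcases (norm_nonneg e).eq_or_lt with h0 | hpos
  · simpa [← h0] using hε
  · exact le_of_mul_le_mul_right (by linarith) hpos
end

section
/- Suppose u, u̇ ∈ V, F : V → ℝ is a continuous linear functional, and ε ≥ 0 satisfy: (i) |F(w)| ≤ ε‖w‖ for all w ∈ W; (ii) a(u, w) = F(w) − b(u̇, w) for all w ∈ W; and (iii) ũ ∈ V satisfies u − ũ ∈ W and a(ũ, w) = 0 for all w ∈ W. Then ‖u − ũ‖ ≤ (ε + γ‖u̇‖)/α. (Abstract form of the order-reduction estimate (2.8) for the plain multiscale projection: the projection error is limited by the term γ‖u̇‖ ≈ H²‖∇∂ₜu‖ coming from the time derivative, regardless of the polynomial degree p.) -/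
/-- abstract order-reduction estimate for the plain multiscale
projection: under the same weak-form hypotheses as for the enriched
correction, `‖u - ũ‖ ≤ (ε + γ ‖u̇‖) / α`. -/
theorem multiscale_projection_order_reduction
    {V : Type*} [NormedAddCommGroup V] [InnerProductSpace ℝ V] [CompleteSpace V]
    (W : Submodule ℝ V) (hWclosed : IsClosed (W : Set V))
    (a : V → V → ℝ)
    (ha_add : ∀ u v w : V, a (u + v) w = a u w + a v w)
    (ha_smul : ∀ (c : ℝ) (u w : V), a (c • u) w = c * a u w)
    (ha_symm : ∀ u v : V, a u v = a v u)
    (α β : ℝ) (hα : 0 < α) (hαβ : α ≤ β)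
    (ha_coercive : ∀ v : V, α * ‖v‖ ^ 2 ≤ a v v)
    (ha_bound : ∀ v w : V, |a v w| ≤ β * ‖v‖ * ‖w‖)
    (b : V → V → ℝ)
    (hb_add_left : ∀ u v w : V, b (u + v) w = b u w + b v w)
    (hb_smul_left : ∀ (c : ℝ) (u w : V), b (c • u) w = c * b u w)
    (hb_add_right : ∀ u v w : V, b u (v + w) = b u v + b u w)
    (hb_smul_right : ∀ (c : ℝ) (u w : V), b u (c • w) = c * b u w)
    (γ : ℝ) (hγ : 0 < γ)
    (hb_bound : ∀ v : V, ∀ w ∈ W, |b v w| ≤ γ * ‖v‖ * ‖w‖)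
    (u udot : V) (F : V →L[ℝ] ℝ) (ε : ℝ) (hε : 0 ≤ ε)
    (hF : ∀ w ∈ W, |F w| ≤ ε * ‖w‖)
    (heq : ∀ w ∈ W, a u w = F w - b udot w)
    (utilde : V) (hutilde_mem : u - utilde ∈ W)
    (hutilde_orth : ∀ w ∈ W, a utilde w = 0) :
    ‖u - utilde‖ ≤ (ε + γ * ‖udot‖) / α := by
  set e := u - utilde with he
  have hae : a u e = a e e := by
    have h := ha_add e utilde e
    rwa [he, sub_add_cancel, ← he, hutilde_orth e hutilde_mem, add_zero] at h
  have hweak := heq e hutilde_mem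
  have hFe := (abs_le.mp (hF e hutilde_mem)).2
  have hbe := (abs_le.mp (hb_bound udot e hutilde_mem)).1
  have hce := ha_coercive e
  have key : ‖e‖ * (‖e‖ * α) ≤ ‖e‖ * (ε + γ * ‖udot‖) := by linarith
  rw [le_div_iff₀ hα]
  rcases (norm_nonneg e).eq_or_lt with h0 | hpos
  · rw [← h0, zero_mul]
    positivity
  · exact le_of_mul_le_mul_left key hpos
end

section
/- Let V be a real inner product space with inner product ⟪·,·⟫ and norm ‖·‖, let a : V → V → ℝ be a continuous symmetric positive-semidefinite bilinear form (a(v,v) ≥ 0 for all v), let T > 0, and let e, φ : ℝ → V be continuously differentiable. Assume for all t ∈ [0,T]: ⟪e′(t), e(t) − φ(t)⟫ + a(e(t), e(t) − φ(t)) = 0 and ⟪e′(t), e′(t) − φ′(t)⟫ + a(e(t), e′(t) − φ′(t)) = 0 (Galerkin orthogonality of the semi-discrete error e tested with e and with e′, where e − φ lies in the discrete space). Then for all t ∈ [0,T]: ‖e(t)‖² + a(e(t), e(t)) ≤ ‖e(0)‖² + a(e(0), e(0)) + ∫₀ᵗ (‖φ(s)‖² + ‖φ′(s)‖² + a(φ(s),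 φ(s)) + a(φ′(s), φ′(s))) ds. (Abstract form of the energy estimate (3.19)–(3.20), Step 1 of the proof of the main semi-discrete error theorem.) -/
open scoped RealInnerProductSpace

theorem two_mul_le_add_of_psd {V : Type*} [NormedAddCommGroup V] [NormedSpace ℝ V]
    (a : V →L[ℝ] V →L[ℝ] ℝ) (ha_symm : ∀ u v : V, a u v = a v u)
    (ha_psd : ∀ v : V, 0 ≤ a v v) (u v : V) : 2 * a u v ≤ a u u + a v v := by
  have h := ha_psd (u - v)
  simp only [map_sub, sub_apply] at h
  linarith [ha_symm u v]

theorem two_mul_inner_le_add_sq {V : Type*} [NormedAddCommGroup V] [InnerProductSpace ℝ V]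
    (u v : V) : 2 * ⟪u, v⟫ ≤ ‖u‖ ^ 2 + ‖v‖ ^ 2 := by
  linarith [norm_sub_sq_real u v, sq_nonneg ‖u - v‖]

/-- abstract parabolic energy estimate: Galerkin orthogonality of
the semi-discrete error `e` tested with `e` and `e'` implies
`‖e t‖² + a(e t, e t) ≤ ‖e 0‖² + a(e 0, e 0) + ∫₀ᵗ (‖φ‖² + ‖φ'‖² + a(φ,φ) + a(φ',φ'))`. -/
theorem parabolic_energy_estimate
    {V : Type*} [NormedAddCommGroup V] [InnerProductSpace ℝ V]
    (a : V →L[ℝ] V →L[ℝ] ℝ)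
    (ha_symm : ∀ u v : V, a u v = a v u)
    (ha_psd : ∀ v : V, 0 ≤ a v v)
    (T : ℝ) (hT : 0 < T)
    (e φ e' φ' : ℝ → V)
    (he : ∀ t : ℝ, HasDerivAt e (e' t) t)
    (hφ : ∀ t : ℝ, HasDerivAt φ (φ' t) t)
    (he'_cont : Continuous e') (hφ'_cont : Continuous φ')
    (hgal1 : ∀ t ∈ Set.Icc (0 : ℝ) T,
      ⟪e' t, e t - φ t⟫ + a (e t) (e t - φ t) = 0)
    (hgal2 : ∀ t ∈ Set.Icc (0 : ℝ) T,
      ⟪e' t, e' t - φ' t⟫ + a (e t) (e' t - φ' t) = 0)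
    (t : ℝ) (ht : t ∈ Set.Icc (0 : ℝ) T) :
    ‖e t‖ ^ 2 + a (e t) (e t) ≤
      ‖e 0‖ ^ 2 + a (e 0) (e 0) +
        ∫ s in (0 : ℝ)..t,
          (‖φ s‖ ^ 2 + ‖φ' s‖ ^ 2 + a (φ s) (φ s) + a (φ' s) (φ' s)) := by
  have hφ_cont : Continuous φ := continuous_iff_continuousAt.2 fun s => (hφ s).continuousAt
  have hderiv : ∀ s, HasDerivAt (fun r => ‖e r‖ ^ 2 + a (e r) (e r))
      (2 * ⟪e s, e' s⟫ + (a (e' s) (e s) + a (e s) (e' s))) s := fun s =>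
    (he s).norm_sq.add ((a.hasFDerivAt.comp_hasDerivAt s (he s)).clm_apply (he s))
  have key := intervalIntegral.sub_le_integral_of_hasDeriv_right_of_le
    (φ := fun s => ‖φ s‖ ^ 2 + ‖φ' s‖ ^ 2 + a (φ s) (φ s) + a (φ' s) (φ' s)) ht.1
    (fun s _ => (hderiv s).continuousAt.continuousWithinAt)
    (fun s _ => (hderiv s).hasDerivWithinAt)
    (Continuous.integrableOn_Icc (by fun_prop))
    (fun s hs => by
      have hsT : s ∈ Set.Icc (0 : ℝ) T := ⟨hs.1.le, hs.2.le.trans ht.2⟩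
      have h1 := hgal1 s hsT
      have h2 := hgal2 s hsT
      simp only [inner_sub_right, map_sub, real_inner_self_eq_norm_sq] at h1 h2
      linarith [two_mul_inner_le_add_sq (e' s) (φ s), two_mul_inner_le_add_sq (e' s) (φ' s),
        two_mul_le_add_of_psd a ha_symm ha_psd (e s) (φ s),
        two_mul_le_add_of_psd a ha_symm ha_psd (e s) (φ' s),
        ha_symm (e s) (e' s), real_inner_comm (e s) (e' s)])
  linarith
end

section
/- Let j ≥ 1 be a natural number and set K := γ/α. Let u₀, u₁, …, u_{j+1} ∈ V (modeling the time derivatives ∂ₜ^ν u of the exact solution), let F₀, …, F_j : V → ℝ be continuous linear functionals and ε₀, …, ε_j ≥ 0 with |F_ν(w)| ≤ ε_ν‖w‖ for all w ∈ W (modeling |⟨∂ₜ^ν f, w⟩| ≲ H^{p+2}‖∂ₜ^ν f‖_{H^k}‖∇w‖ for kernel functions w). Assume the weak-form relations a(u_ν, w) = F_ν(w) − b(u_{ν+1}, w) for all w ∈ W and ν = 0, …, j (the differentiated parabolic equation tested with kernel functions), and assume for each ν = 0, …, j+1 there is ũ_ν ∈ V with u_ν − ũ_ν ∈ W and a(ũ_ν,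 w) = 0 for all w ∈ W (the a-orthogonal multiscale projections). Then the enriched multiscale deviation φ := u₀ − ũ₀ − Σ_{ν=1}^{j} D^ν ũ_ν satisfies ‖φ‖ ≤ (1/α)(ε₀ + Σ_{ν=1}^{j} K^ν ε_ν) + K^{j+1}(1 + 2β/α)‖u_{j+1}‖. (Abstract form of the key estimate (3.34) in Step 3 of the proof of the main theorem: with j ≈ p/2 enriched corrections the deviation is of order H^{p+2} + H^{2j+2}.) -/
/-- A coercive form bounds an element by any bound on the functional it represents. -/
theorem norm_le_div_of_coercive_of_le {V : Type*} [NormedAddCommGroup V] (a : V → V → ℝ)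
    {α c : ℝ} (hα : 0 < α) (hc : 0 ≤ c) {v : V} (hv : α * ‖v‖ ^ 2 ≤ a v v)
    (h : a v v ≤ c * ‖v‖) : ‖v‖ ≤ c / α := by
  rw [le_div_iff₀ hα]
  rcases (norm_nonneg v).eq_or_lt with h0 | h0
  · simpa [← h0] using hc
  · exact le_of_mul_le_mul_right (by nlinarith) h0

/-- Iterates of a map that preserves subtraction preserve subtraction. -/
theorem iterate_sub_of_forall_sub {G : Type*} [Sub G] {D : G → G}
    (hD : ∀ x y, D (x - y) = D x - D y) (n : ℕ) (x y : G) :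
    D^[n] (x - y) = D^[n] x - D^[n] y :=
  (Function.Semiconj₂.iterate (f := D) (op := (· - ·)) hD n) x y

/-- Iterates of a map bounded by `K` are bounded by the powers of `K`. -/
theorem norm_iterate_le_pow_mul {V : Type*} [Norm V] {D : V → V} {K : ℝ} (hK : 0 ≤ K)
    (hD : ∀ v, ‖D v‖ ≤ K * ‖v‖) (n : ℕ) (v : V) : ‖D^[n] v‖ ≤ K ^ n * ‖v‖ := by
  induction n with
  | zero => simp
  | succ n ih =>
    rw [Function.iterate_succ_apply', pow_succ', mul_assoc]
    exact (hD _).trans (mul_le_mul_of_nonneg_left ih hK)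

/-- Unrolling the recursion `u ν - p ν ≈ D (u (ν + 1))` with error at most `δ ν` in each step. -/
theorem norm_sub_sum_iterate_le {V : Type*} [NormedAddCommGroup V] {D : V → V} {K : ℝ}
    (hK : 0 ≤ K) (hsub : ∀ x y, D (x - y) = D x - D y) (hD : ∀ v, ‖D v‖ ≤ K * ‖v‖)
    {u p : ℕ → V} {δ : ℕ → ℝ} {n : ℕ}
    (hstep : ∀ ν ≤ n, ‖u ν - p ν - D (u (ν + 1))‖ ≤ δ ν) :
    ‖u 0 - p 0 - ∑ ν ∈ Finset.Icc 1 n, D^[ν] (p ν) - D^[n + 1] (u (n + 1))‖ ≤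
      δ 0 + ∑ ν ∈ Finset.Icc 1 n, K ^ ν * δ ν := by
  induction n with
  | zero => simpa using hstep 0 le_rfl
  | succ n ih =>
    have key : u 0 - p 0 - ∑ ν ∈ Finset.Icc 1 (n + 1), D^[ν] (p ν)
          - D^[n + 1 + 1] (u (n + 1 + 1)) =
        (u 0 - p 0 - ∑ ν ∈ Finset.Icc 1 n, D^[ν] (p ν) - D^[n + 1] (u (n + 1))) +
          D^[n + 1] (u (n + 1) - p (n + 1) - D (u (n + 1 + 1))) := by
      rw [Finset.sum_Icc_succ_top (by omega), iterate_sub_of_forall_sub hsub,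
        iterate_sub_of_forall_sub hsub, Function.iterate_succ_apply D (n + 1)]
      abel
    rw [key, Finset.sum_Icc_succ_top (by omega), ← add_assoc]
    exact (norm_add_le _ _).trans (add_le_add (ih fun ν hν => hstep ν (by omega))
      ((norm_iterate_le_pow_mul hK hD _ _).trans
        (mul_le_mul_of_nonneg_left (hstep _ le_rfl) (pow_nonneg hK _))))

/-- key estimate of Step 3 of the main theorem: with `K = γ/α`,
the enriched multiscale deviation `φ = u₀ - ũ₀ - Σ_{ν=1}^{j} D^ν ũ_ν`
satisfies `‖φ‖ ≤ (1/α)(ε₀ + Σ_{ν=1}^{j} K^ν ε_ν) + K^{j+1}(1 + 2β/α)‖u_{j+1}‖`. -/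
theorem enriched_deviation_estimate
    {V : Type*} [NormedAddCommGroup V] [InnerProductSpace ℝ V] [CompleteSpace V]
    (W : Submodule ℝ V) (hWclosed : IsClosed (W : Set V))
    (a : V → V → ℝ)
    (ha_add : ∀ u v w : V, a (u + v) w = a u w + a v w)
    (ha_smul : ∀ (c : ℝ) (u w : V), a (c • u) w = c * a u w)
    (ha_symm : ∀ u v : V, a u v = a v u)
    (α β : ℝ) (hα : 0 < α) (hαβ : α ≤ β)
    (ha_coercive : ∀ v : V, α * ‖v‖ ^ 2 ≤ a v v)
    (ha_bound : ∀ v w : V, |a v w| ≤ β * ‖v‖ * ‖w‖)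
    (b : V → V → ℝ)
    (hb_add_left : ∀ u v w : V, b (u + v) w = b u w + b v w)
    (hb_smul_left : ∀ (c : ℝ) (u w : V), b (c • u) w = c * b u w)
    (hb_add_right : ∀ u v w : V, b u (v + w) = b u v + b u w)
    (hb_smul_right : ∀ (c : ℝ) (u w : V), b u (c • w) = c * b u w)
    (γ : ℝ) (hγ : 0 < γ)
    (hb_bound : ∀ v : V, ∀ w ∈ W, |b v w| ≤ γ * ‖v‖ * ‖w‖)
    -- the enriched correction operator D
    (D : V → V) (hD_mem : ∀ v : V, D v ∈ W)
    (hD_eq : ∀ v : V, ∀ w ∈ W, a (D v) w = - b v w)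
    -- data
    (j : ℕ) (hj : 1 ≤ j)
    (u : ℕ → V) (F : ℕ → V →L[ℝ] ℝ) (ε : ℕ → ℝ)
    (hε : ∀ ν ≤ j, 0 ≤ ε ν)
    (hF : ∀ ν ≤ j, ∀ w ∈ W, |F ν w| ≤ ε ν * ‖w‖)
    (heq : ∀ ν ≤ j, ∀ w ∈ W, a (u ν) w = F ν w - b (u (ν + 1)) w)
    (utilde : ℕ → V)
    (hproj_mem : ∀ ν ≤ j + 1, u ν - utilde ν ∈ W)
    (hproj_orth : ∀ ν ≤ j + 1, ∀ w ∈ W, a (utilde ν) w = 0) :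
    ‖u 0 - utilde 0 - ∑ ν ∈ Finset.Icc 1 j, D^[ν] (utilde ν)‖ ≤
      (1 / α) * (ε 0 + ∑ ν ∈ Finset.Icc 1 j, (γ / α) ^ ν * ε ν) +
        (γ / α) ^ (j + 1) * (1 + 2 * β / α) * ‖u (j + 1)‖ := by
  have ha_sub : ∀ x y w, a (x - y) w = a x w - a y w := fun x y w => by
    have h := ha_add (x - y) y w
    rw [sub_add_cancel] at h
    linarith
  have hb_sub : ∀ x y w, b (x - y) w = b x w - b y w := fun x y w => by
    have h := hb_add_left (x - y) y w
    rw [sub_add_cancel] at h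
    linarith
  have hK : 0 ≤ γ / α := by positivity
  have hD_sub : ∀ x y, D (x - y) = D x - D y := fun x y => by
    have hmem := W.sub_mem (hD_mem (x - y)) (W.sub_mem (hD_mem x) (hD_mem y))
    have hzero : a (D (x - y) - (D x - D y)) (D (x - y) - (D x - D y)) = 0 := by
      rw [ha_sub, ha_sub (D x), hD_eq _ _ hmem, hD_eq _ _ hmem, hD_eq _ _ hmem, hb_sub]
      ring
    have h := norm_le_div_of_coercive_of_le a hα le_rfl (ha_coercive _) (by rw [hzero, zero_mul])
    rw [zero_div] at h
    exact sub_eq_zero.mp (norm_le_zero_iff.mp h)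
  have hD_norm : ∀ v, ‖D v‖ ≤ γ / α * ‖v‖ := fun v => by
    rw [div_mul_eq_mul_div]
    refine norm_le_div_of_coercive_of_le a hα (by positivity) (ha_coercive _) ?_
    rw [hD_eq v _ (hD_mem v)]
    exact (neg_le_abs _).trans (hb_bound v _ (hD_mem v))
  have hstep : ∀ ν ≤ j, ‖u ν - utilde ν - D (u (ν + 1))‖ ≤ ε ν / α := fun ν hν => by
    have hmem := W.sub_mem (hproj_mem ν (by omega)) (hD_mem (u (ν + 1)))
    refine norm_le_div_of_coercive_of_le a hα (hε ν hν) (ha_coercive _) ?_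
    rw [ha_sub, ha_sub (u ν), heq ν hν _ hmem, hproj_orth ν (by omega) _ hmem, hD_eq _ _ hmem,
      sub_zero, sub_neg_eq_add, sub_add_cancel]
    exact (le_abs_self _).trans (hF ν hν _ hmem)
  have hsum := norm_sub_sum_iterate_le hK hD_sub hD_norm hstep
  have htail := norm_iterate_le_pow_mul hK hD_norm (j + 1) (u (j + 1))
  have hβ : 0 ≤ 2 * β / α := div_nonneg (by linarith) hα.le
  calc _ ≤ _ := norm_le_norm_sub_add _ (D^[j + 1] (u (j + 1)))
    _ ≤ _ := add_le_add hsum htail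
    _ ≤ _ := by
      refine add_le_add (le_of_eq ?_) ?_
      · rw [mul_add, Finset.mul_sum]
        congr 1
        · ring
        · exact Finset.sum_congr rfl fun ν _ => by ring
      · gcongr
        exact le_mul_of_one_le_right (by positivity) (by linarith)
end
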